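/- Sharp Rubio de Francia algorithm: Let 1 ≤ r₀ < r < ∞, let v be a weight on ℝⁿ with v ∈ A_r, and let g be a non-negative function in L^{(r/r₀)′}(v). Then there exists a function G on ℝⁿ such that: (1) G ≥ g pointwise; (2) ‖G‖_{L^{(r/r₀)′}(v)} ≤ 2 ‖g‖_{L^{(r/r₀)′}(v)}; (3) G·v ∈ A_{r₀} with [G·v]_{A_{r₀}} ≤ c [v]_{A_r}, where c depends only on n, r, and r₀. -/

import Mathlib

open MeasureTheory ENNReal Set

noncomputable section

/-- Euclidean space `ℝⁿ`. -/
abbrev Euc (n : ℕ) := EuclideanSpace ℝ (Fin n)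

variable {n : ℕ}

/-- The axis-parallel closed cube with lower corner `a` and side length `h`. -/
def Cube (a : Euc n) (h : ℝ) : Set (Euc n) :=
  {x | ∀ i, a i ≤ x i ∧ x i ≤ a i + h}

/-- The weighted measure `u(E) = ∫_E u dx` of a set. -/
def wMeas (u : Euc n → ℝ) (E : Set (Euc n)) : ℝ≥0∞ :=
  ∫⁻ x in E, ENNReal.ofReal (u x)

/-- The dual exponent `p' = p/(p-1)`. -/
def dualExp (p : ℝ) : ℝ := p / (p - 1)

/-- The `A_{p,q}` constant of a weight `w` (with the `A_{1,q}` convention when `p = 1`). -/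
def Apq (p q : ℝ) (w : Euc n → ℝ) : ℝ≥0∞ :=
  ⨆ (a : Euc n) (h : ℝ) (_ : 0 < h),
    ((volume (Cube a h))⁻¹ * ∫⁻ x in Cube a h, ENNReal.ofReal (w x) ^ q) *
      (if p = 1 then
        (essSup (fun x => (ENNReal.ofReal (w x))⁻¹) (volume.restrict (Cube a h))) ^ q
      else
        ((volume (Cube a h))⁻¹ * ∫⁻ x in Cube a h,
            ENNReal.ofReal (w x) ^ (-(dualExp p))) ^ (q / dualExp p))

/-- The weighted Lebesgue norm `‖w f‖_{L^p(ℝⁿ)}`. -/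
def wLp (w f : Euc n → ℝ) (p : ℝ) : ℝ≥0∞ :=
  (∫⁻ x, (ENNReal.ofReal (w x) * ENNReal.ofReal |f x|) ^ p) ^ (1 / p)

/-- The weighted Lebesgue norm `‖w g‖_{L^q(ℝⁿ)}` of an `ℝ≥0∞`-valued function. -/
def wLpE (w : Euc n → ℝ) (g : Euc n → ℝ≥0∞) (q : ℝ) : ℝ≥0∞ :=
  (∫⁻ x, (ENNReal.ofReal (w x) * g x) ^ q) ^ (1 / q)

/-- The weak norm `‖g‖_{L^{q,∞}(u)} = sup_{λ>0} λ u({|g|>λ})^{1/q}`. -/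
def weakLp (u : Euc n → ℝ) (g : Euc n → ℝ) (q : ℝ) : ℝ≥0∞ :=
  ⨆ (t : ℝ) (_ : 0 < t), ENNReal.ofReal t * wMeas u {x | t < |g x|} ^ (1 / q)

/-- The weak norm of an `ℝ≥0∞`-valued function. -/
def weakLpE (u : Euc n → ℝ) (g : Euc n → ℝ≥0∞) (q : ℝ) : ℝ≥0∞ :=
  ⨆ (t : ℝ) (_ : 0 < t), ENNReal.ofReal t * wMeas u {x | ENNReal.ofReal t < g x} ^ (1 / q)

/-- The fractional integral (Riesz potential) `I_α f(x) = ∫ |f(y)| |x-y|^{α-n} dy`. -/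
def riesz (α : ℝ) (f : Euc n → ℝ) (x : Euc n) : ℝ≥0∞ :=
  ∫⁻ y, ENNReal.ofReal |f y| * ENNReal.ofReal (‖x - y‖ ^ (α - (n : ℝ)))

/-- The fractional maximal operator `M_α f(x) = sup_{Q ∋ x} |Q|^{α/n-1} ∫_Q |f|`. -/
def fracMax (α : ℝ) (f : Euc n → ℝ) (x : Euc n) : ℝ≥0∞ :=
  ⨆ (a : Euc n) (h : ℝ) (_ : 0 < h) (_ : x ∈ Cube a h),
    volume (Cube a h) ^ (α / (n : ℝ) - 1) * ∫⁻ y in Cube a h, ENNReal.ofReal |f y|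


/-- The Muckenhoupt `A_r` constant of a weight `v` (with the `A_1` convention
when `r = 1`). -/
def Ar (r : ℝ) (v : Euc n → ℝ) : ℝ≥0∞ :=
  ⨆ (a : Euc n) (h : ℝ) (_ : 0 < h),
    ((volume (Cube a h))⁻¹ * ∫⁻ x in Cube a h, ENNReal.ofReal (v x)) *
      (if r = 1 then
        essSup (fun x => (ENNReal.ofReal (v x))⁻¹) (volume.restrict (Cube a h))
      else
        ((volume (Cube a h))⁻¹ * ∫⁻ x in Cube a h,
            ENNReal.ofReal (v x) ^ (1 - dualExp r)) ^ (r - 1))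

/-- The norm `‖g‖_{L^s(v)} = (∫ |g|^s v dx)^{1/s}`. -/
def vLp (v g : Euc n → ℝ) (s : ℝ) : ℝ≥0∞ :=
  (∫⁻ x, ENNReal.ofReal |g x| ^ s * ENNReal.ofReal (v x)) ^ (1 / s)

/-- The closed cube centred at `x` with half side `ρ`. -/
def CQ (x : Euc n) (ρ : ℝ) : Set (Euc n) := {y | ∀ i, |y i - x i| ≤ ρ}

lemma CQ_eq_Cube (x : Euc n) (ρ : ℝ) :
    CQ x ρ = Cube (WithLp.toLp 2 (fun i => x i - ρ)) (2 * ρ) := by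
  ext y
  simp only [CQ, Cube, mem_ofPred_eq, abs_le]
  refine forall_congr' fun i => ?_
  constructor <;> rintro ⟨h1, h2⟩ <;> constructor <;> linarith

lemma Cube_eq_preimage (a : Euc n) (h : ℝ) :
    Cube a h = (@WithLp.ofLp 2 (Fin n → ℝ)) ⁻¹' (Icc (fun i => a i) (fun i => a i + h)) := by
  ext y
  simp [Cube, Pi.le_def, forall_and]

lemma volume_Cube (a : Euc n) (h : ℝ) : volume (Cube a h) = ENNReal.ofReal h ^ n := by
  rw [Cube_eq_preimage, (PiLp.volume_preserving_ofLp (Fin n)).measure_preimage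
    measurableSet_Icc.nullMeasurableSet, Real.volume_Icc_pi]
  simp

lemma measurableSet_Cube (a : Euc n) (h : ℝ) : MeasurableSet (Cube a h) := by
  rw [Cube_eq_preimage]
  exact (PiLp.volume_preserving_ofLp (Fin n)).measurable measurableSet_Icc

lemma measurableSet_CQ (x : Euc n) (h : ℝ) : MeasurableSet (CQ x h) := by
  rw [CQ_eq_Cube]; exact measurableSet_Cube _ _

lemma volume_CQ (x : Euc n) (h : ℝ) : volume (CQ x h) = ENNReal.ofReal (2 * h) ^ n := by
  rw [CQ_eq_Cube, volume_Cube]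

lemma measurableSet_CQ_prod (ρ : ℝ) :
    MeasurableSet {p : Euc n × Euc n | p.2 ∈ CQ p.1 ρ} := by
  have : {p : Euc n × Euc n | p.2 ∈ CQ p.1 ρ} = ⋂ i, {p | |p.2 i - p.1 i| ≤ ρ} := by
    ext p; simp [CQ]
  rw [this]
  refine MeasurableSet.iInter fun i => ?_
  exact measurableSet_le (by fun_prop) measurable_const

/-- The centred dyadic-radius maximal operator with respect to `μ`. -/
def Mx (μ : Measure (Euc n)) (f : Euc n → ℝ≥0∞) (x : Euc n) : ℝ≥0∞ :=
  ⨆ k : ℤ, (∫⁻ y in CQ x ((2:ℝ) ^ k), f y ∂μ) / μ (CQ x ((2:ℝ) ^ k))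

lemma measurable_quot (μ : Measure (Euc n)) [SFinite μ] {f : Euc n → ℝ≥0∞} (hf : Measurable f)
    (ρ : ℝ) : Measurable fun x => (∫⁻ y in CQ x ρ, f y ∂μ) / μ (CQ x ρ) := by
  refine Measurable.div ?_ ?_
  · have : (fun x => ∫⁻ y in CQ x ρ, f y ∂μ) = fun x => ∫⁻ y,
        (({p : Euc n × Euc n | p.2 ∈ CQ p.1 ρ}).indicator (fun p => f p.2)) (x, y) ∂μ := by
      ext x
      rw [← lintegral_indicator (measurableSet_CQ x ρ)]
      rfl
    rw [this]
    exact ((hf.comp measurable_snd).indicator (measurableSet_CQ_prod ρ)).lintegral_prod_right'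
  · exact measurable_measure_prodMk_left (measurableSet_CQ_prod (n := n) ρ)

lemma measurable_Mx (μ : Measure (Euc n)) [SFinite μ] {f : Euc n → ℝ≥0∞} (hf : Measurable f) :
    Measurable (Mx μ f) :=
  Measurable.iSup fun k => measurable_quot μ hf _

lemma CQ_eq_preimage_ball (x : Euc n) {ρ : ℝ} (h : 0 ≤ ρ) :
    CQ x ρ = (@WithLp.ofLp 2 (Fin n → ℝ)) ⁻¹' (Metric.closedBall (WithLp.ofLp x) ρ) := by
  ext y
  simp [CQ, dist_pi_le_iff h, Real.dist_eq]

lemma besicovitch_CQ (n : ℕ) : ∃ N : ℕ, ∀ (s : Set (Euc n)) (ρ : Euc n → ℝ) (R : ℝ),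
    (∀ x ∈ s, 0 < ρ x) → (∀ x ∈ s, ρ x ≤ R) →
    ∃ t : Fin N → Set (Euc n), (∀ i, t i ⊆ s) ∧ (∀ i, (t i).Countable) ∧
      (∀ i, (t i).PairwiseDisjoint fun x => CQ x (ρ x)) ∧
      s ⊆ ⋃ i, ⋃ x ∈ t i, CQ x (ρ x) := by
  obtain ⟨N, τ, hτ, hN⟩ := HasBesicovitchCovering.no_satelliteConfig (α := Fin n → ℝ)
  refine ⟨N, fun s ρ R h0 hR => ?_⟩
  let q : Besicovitch.BallPackage s (Fin n → ℝ) :=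
    { c := fun x => WithLp.ofLp x.1
      r := fun x => ρ x.1
      rpos := fun x => h0 x.1 x.2
      r_bound := R
      r_le := fun x => hR x.1 x.2 }
  obtain ⟨t, ht, hcov⟩ := Besicovitch.exist_disjoint_covering_families hτ hN q
  have hcount : ∀ i, (t i).Countable := fun i => by
    refine (ht i).countable_of_nonempty_interior fun j hj => ?_
    exact ⟨q.c j, Metric.ball_subset_interior_closedBall (Metric.mem_ball_self (q.rpos j))⟩
  refine ⟨fun i => Subtype.val '' t i, fun i => ?_, fun i => (hcount i).image _, fun i => ?_, ?_⟩
  · rintro _ ⟨x, _, rfl⟩; exact x.2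
  · rintro _ ⟨x, hx, rfl⟩ _ ⟨y, hy, rfl⟩ hxy
    have := ht i hx hy (fun h => hxy (by rw [h]))
    simp only [Function.onFun] at this ⊢
    rw [CQ_eq_preimage_ball _ (h0 _ x.2).le, CQ_eq_preimage_ball _ (h0 _ y.2).le]
    exact Disjoint.preimage _ this
  · intro x hx
    have := hcov ⟨⟨x, hx⟩, rfl⟩
    simp only [mem_iUnion] at this ⊢
    obtain ⟨i, j, hj, hb⟩ := this
    refine ⟨i, j.1, ⟨j, hj, rfl⟩, ?_⟩
    rw [CQ_eq_preimage_ball _ (h0 _ j.2).le]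
    exact Metric.ball_subset_closedBall hb

lemma weak_aux (n : ℕ) : ∃ N : ℕ, ∀ (μ : Measure (Euc n)) (f : Euc n → ℝ≥0∞), Measurable f →
    ∀ t : ℝ≥0∞, t ≠ 0 → t ≠ ⊤ →
    μ {x | t < Mx μ f x} ≤ (2 * N) * t⁻¹ * ∫⁻ y in {y | t / 2 < f y}, f y ∂μ := by
  obtain ⟨N, hN⟩ := besicovitch_CQ n
  refine ⟨N, fun μ f hf t ht0 ht => ?_⟩
  set f1 := ({y | t / 2 < f y}).indicator f with hf1
  have hms : MeasurableSet {y | t / 2 < f y} := measurableSet_lt measurable_const hf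
  have hf1m : Measurable f1 := hf.indicator hms
  have key : ∀ s : Set (Euc n), MeasurableSet s → t < (∫⁻ y in s, f y ∂μ) / μ s →
      μ s ≤ 2 * t⁻¹ * ∫⁻ y in s, f1 y ∂μ := by
    intro s hs h
    have hs0 : μ s ≠ 0 := by
      intro h0
      rw [setLIntegral_measure_zero _ _ h0] at h
      simp at h
    have hst : μ s ≠ ⊤ := by
      intro h0
      rw [h0] at h; simp at h
    have h1 : t * μ s ≤ ∫⁻ y in s, f y ∂μ :=
      (ENNReal.mul_lt_of_lt_div h).le
    have h2 : ∫⁻ y in s, f y ∂μ ≤ ∫⁻ y in s, f1 y ∂μ + t / 2 * μ s := by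
      rw [← setLIntegral_const, ← lintegral_add_left hf1m]
      refine lintegral_mono fun y => ?_
      by_cases hy : t / 2 < f y
      · simp [hf1, indicator, hy]
      · simp only [hf1, indicator, mem_ofPred_eq, hy, if_false, zero_add]
        exact not_lt.1 hy
    have h3 : t / 2 * μ s ≤ ∫⁻ y in s, f1 y ∂μ := by
      have h4 : t / 2 * μ s + t / 2 * μ s ≤ ∫⁻ y in s, f1 y ∂μ + t / 2 * μ s := by
        rw [← add_mul, ENNReal.add_halves]; exact h1.trans h2
      exact (ENNReal.add_le_add_iff_right
        (ENNReal.mul_ne_top (ENNReal.div_ne_top ht (by simp)) hst)).1 h4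
    calc μ s = 2 * t⁻¹ * (t / 2 * μ s) := by
          rw [← mul_assoc, div_eq_mul_inv, show 2 * t⁻¹ * (t * 2⁻¹) = (2 * 2⁻¹) * (t * t⁻¹) by ring,
            ENNReal.mul_inv_cancel ht0 ht, ENNReal.mul_inv_cancel (by simp) (by simp)]
          simp
      _ ≤ _ := by gcongr
  have bd : ∀ K : ℕ, μ {x | ∃ k : ℤ, k ≤ K ∧
      t < (∫⁻ y in CQ x ((2:ℝ) ^ k), f y ∂μ) / μ (CQ x ((2:ℝ) ^ k))} ≤
      (2 * N) * t⁻¹ * ∫⁻ y, f1 y ∂μ := by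
    intro K
    set s := {x | ∃ k : ℤ, k ≤ K ∧
      t < (∫⁻ y in CQ x ((2:ℝ) ^ k), f y ∂μ) / μ (CQ x ((2:ℝ) ^ k))} with hs
    have : ∀ x : Euc n, ∃ k : ℤ, x ∈ s → k ≤ K ∧
      t < (∫⁻ y in CQ x ((2:ℝ) ^ k), f y ∂μ) / μ (CQ x ((2:ℝ) ^ k)) := by
      intro x
      by_cases hx : x ∈ s
      · obtain ⟨k, hk⟩ := hx
        exact ⟨k, fun _ => hk⟩
      · exact ⟨0, fun h => absurd h hx⟩
    choose k hk using this
    obtain ⟨T, hTs, hTc, hTd, hTcov⟩ := hN s (fun x => (2:ℝ) ^ k x) ((2:ℝ) ^ (K:ℤ))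
      (fun x _ => by positivity)
      (fun x hx => zpow_le_zpow_right₀ (by norm_num) (hk x hx).1)
    calc μ s ≤ μ (⋃ i, ⋃ x ∈ T i, CQ x ((2:ℝ) ^ k x)) := measure_mono hTcov
      _ ≤ ∑ i, μ (⋃ x ∈ T i, CQ x ((2:ℝ) ^ k x)) := measure_iUnion_fintype_le _ _
      _ ≤ ∑ i : Fin N, 2 * t⁻¹ * ∫⁻ y, f1 y ∂μ := by
          refine Finset.sum_le_sum fun i _ => ?_
          have := (hTc i).to_subtype
          calc μ (⋃ x ∈ T i, CQ x ((2:ℝ) ^ k x)) ≤ ∑' x : T i, μ (CQ x.1 ((2:ℝ) ^ k x.1)) :=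
                measure_biUnion_le _ (hTc i) _
            _ ≤ ∑' x : T i, 2 * t⁻¹ * ∫⁻ y in CQ x.1 ((2:ℝ) ^ k x.1), f1 y ∂μ :=
                ENNReal.tsum_le_tsum fun x =>
                  key _ (measurableSet_CQ _ _) (hk x.1 (hTs i x.2)).2
            _ = 2 * t⁻¹ * ∫⁻ y in ⋃ x ∈ T i, CQ x ((2:ℝ) ^ k x), f1 y ∂μ := by
                rw [ENNReal.tsum_mul_left,
                  lintegral_biUnion (hTc i) (fun x _ => measurableSet_CQ _ _) (hTd i)]
            _ ≤ _ := by gcongr; exact Measure.restrict_le_self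
      _ = _ := by simp; ring
  have hun : {x | t < Mx μ f x} ⊆ ⋃ K : ℕ, {x | ∃ k : ℤ, k ≤ K ∧
      t < (∫⁻ y in CQ x ((2:ℝ) ^ k), f y ∂μ) / μ (CQ x ((2:ℝ) ^ k))} := by
    intro x hx
    have hx2 : t < Mx μ f x := hx
    obtain ⟨k, hk⟩ := lt_iSup_iff.1 hx2
    exact mem_iUnion.2 ⟨k.toNat, k, Int.self_le_toNat k, hk⟩
  calc _ ≤ _ := measure_mono hun
    _ = _ := Monotone.measure_iUnion (by
        intro a b hab x ⟨k, hk, h⟩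
        exact ⟨k, hk.trans (by exact_mod_cast hab), h⟩)
    _ ≤ (2 * N) * t⁻¹ * ∫⁻ y, f1 y ∂μ := iSup_le bd
    _ = _ := by rw [hf1, lintegral_indicator hms]

lemma two_zpow_rpow (k : ℤ) : (2:ℝ≥0∞) ^ k = (2:ℝ≥0∞) ^ (k:ℝ) := (ENNReal.rpow_intCast _ _).symm

lemma layer_lower (a : ℝ≥0∞) {q : ℝ} (hq : 1 < q) :
    a ^ q ≤ ∑' k : ℤ, ((2:ℝ≥0∞) ^ (k+1)) ^ q * (if (2:ℝ≥0∞) ^ k < a then 1 else 0) := by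
  have q0 : 0 < q := by linarith
  rcases eq_or_ne a 0 with rfl | h0
  · simp [ENNReal.zero_rpow_of_pos q0]
  rcases eq_or_ne a ⊤ with rfl | ht
  · rw [ENNReal.top_rpow_of_pos q0, top_le_iff, ← top_le_iff, ← ENNReal.iSup_natCast]
    refine iSup_le fun m => ?_
    refine le_trans ?_ (ENNReal.le_tsum (m : ℤ))
    have h2 : (2:ℝ≥0∞) ^ (m:ℤ) < ⊤ := by
      rw [zpow_natCast]; exact ENNReal.pow_lt_top (by simp)
    rw [ENNReal.iSup_natCast, if_pos h2, mul_one]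
    have h3 : (m:ℝ≥0∞) ≤ (2:ℝ≥0∞) ^ ((m:ℤ)+1) := by
      have : (m:ℤ)+1 = ((m+1 : ℕ) : ℤ) := by simp
      rw [this, zpow_natCast]
      have h4 : m ≤ 2 ^ (m+1) := (Nat.lt_two_pow_self).le.trans (Nat.pow_le_pow_right (by norm_num) (by omega))
      exact_mod_cast h4
    have h5 : (1:ℝ≥0∞) ≤ (2:ℝ≥0∞) ^ ((m:ℤ)+1) := by
      have : (m:ℤ)+1 = ((m+1 : ℕ) : ℤ) := by simp
      rw [this, zpow_natCast]
      exact one_le_pow₀ (by norm_num)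
    calc (m:ℝ≥0∞) ≤ _ := h3
      _ = ((2:ℝ≥0∞) ^ ((m:ℤ)+1)) ^ (1:ℝ) := by simp
      _ ≤ _ := ENNReal.rpow_le_rpow_of_exponent_le h5 hq.le
  · obtain ⟨k, hk1, hk2⟩ := ENNReal.exists_mem_Ioc_zpow h0 ht (y := 2) (by norm_num) (by simp)
    refine le_trans ?_ (ENNReal.le_tsum k)
    rw [if_pos hk1, mul_one]
    exact ENNReal.rpow_le_rpow hk2 q0.le

lemma layer_upper {q : ℝ} (hq : 1 < q) : ∃ C : ℝ≥0∞, C ≠ ⊤ ∧ ∀ a : ℝ≥0∞,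
    ∑' k : ℤ, ((2:ℝ≥0∞) ^ (k+1)) ^ q * (((2:ℝ≥0∞) ^ k)⁻¹ *
      (if (2:ℝ≥0∞) ^ k / 2 < a then a else 0)) ≤ C * a ^ q := by
  have q0 : 0 < q := by linarith
  have hb : (2:ℝ≥0∞) ^ (-(q-1)) < 1 := ENNReal.rpow_lt_one_of_one_lt_of_neg (by norm_num) (by linarith)
  set b := (2:ℝ≥0∞) ^ (-(q-1)) with hbdef
  refine ⟨(2:ℝ≥0∞) ^ q * (2:ℝ≥0∞) ^ (q-1) * (1 - b)⁻¹ + 1, ?_, fun a => ?_⟩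
  · refine ENNReal.add_ne_top.2 ⟨?_, by simp⟩
    refine ENNReal.mul_ne_top (ENNReal.mul_ne_top ?_ ?_) ?_
    · exact ENNReal.rpow_ne_top_of_nonneg q0.le (by simp)
    · exact ENNReal.rpow_ne_top_of_nonneg (by linarith) (by simp)
    · exact ENNReal.inv_ne_top.2 (tsub_pos_of_lt hb).ne'
  rcases eq_or_ne a 0 with rfl | h0
  · simp
  rcases eq_or_ne a ⊤ with rfl | ht
  · rw [ENNReal.top_rpow_of_pos q0, ENNReal.mul_top (by simp)]; exact le_top
  obtain ⟨m, hm1, hm2⟩ := ENNReal.exists_mem_Ioc_zpow h0 ht (y := 2) (by norm_num) (by simp)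
  set F : ℤ → ℝ≥0∞ := fun k => ((2:ℝ≥0∞) ^ (k+1)) ^ q * (((2:ℝ≥0∞) ^ k)⁻¹ *
      (if (2:ℝ≥0∞) ^ k / 2 < a then a else 0)) with hF
  have hinj : Function.Injective (fun j : ℕ => m + 1 - (j:ℤ)) := by
    intro i j h; simp at h; exact h
  have hsupp : Function.support F ⊆ range (fun j : ℕ => m + 1 - (j:ℤ)) := by
    intro k hk
    have hk' : (2:ℝ≥0∞) ^ k / 2 < a := by
      by_contra h
      exact hk (by simp [hF, h])
    have h1 : (2:ℝ≥0∞) ^ (k - 1) < (2:ℝ≥0∞) ^ (m+1) := by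
      rw [ENNReal.zpow_sub (by simp) (by simp)]
      simpa [div_eq_mul_inv] using hk'.trans_le hm2
    have h2 : k - 1 < m + 1 := by
      by_contra h
      exact absurd h1 (not_lt.2 (ENNReal.zpow_le_of_le (by norm_num) (not_lt.1 h)))
    exact ⟨(m + 1 - k).toNat, by simp; omega⟩
  rw [show (∑' k : ℤ, ((2:ℝ≥0∞) ^ (k+1)) ^ q * (((2:ℝ≥0∞) ^ k)⁻¹ *
      (if (2:ℝ≥0∞) ^ k / 2 < a then a else 0))) = ∑' k, F k from rfl, ← hinj.tsum_eq hsupp]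
  have hterm : ∀ j : ℕ, F (m + 1 - (j:ℤ)) ≤ ((2:ℝ≥0∞) ^ q * (2:ℝ≥0∞) ^ (q-1) * a ^ q) * b ^ j := by
    intro j
    have e1 : ((2:ℝ≥0∞) ^ (m + 1 - (j:ℤ) + 1)) ^ q * ((2:ℝ≥0∞) ^ (m + 1 - (j:ℤ)))⁻¹ =
        (2:ℝ≥0∞) ^ q * (2:ℝ≥0∞) ^ (q-1) * ((2:ℝ≥0∞) ^ m) ^ (q-1) * b ^ j := by
      rw [two_zpow_rpow, two_zpow_rpow, two_zpow_rpow, hbdef, ← ENNReal.rpow_natCast, ← ENNReal.rpow_mul,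
        ← ENNReal.rpow_mul, ← ENNReal.rpow_mul, ← ENNReal.rpow_neg,
        ← ENNReal.rpow_add _ _ (by simp) (by simp), ← ENNReal.rpow_add _ _ (by simp) (by simp),
        ← ENNReal.rpow_add _ _ (by simp) (by simp), ← ENNReal.rpow_add _ _ (by simp) (by simp)]
      congr 1
      push_cast
      ring
    have e2 : a ^ q = a ^ (q-1) * a := by
      conv_rhs => rw [← ENNReal.rpow_one a, ← ENNReal.rpow_mul, one_mul]
      rw [← ENNReal.rpow_add _ _ h0 ht]; congr 1; ring
    calc F (m + 1 - (j:ℤ)) ≤ ((2:ℝ≥0∞) ^ (m + 1 - (j:ℤ) + 1)) ^ q *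
          (((2:ℝ≥0∞) ^ (m + 1 - (j:ℤ)))⁻¹ * a) := by
            simp only [hF]
            gcongr
            split_ifs <;> simp
      _ = (2:ℝ≥0∞) ^ q * (2:ℝ≥0∞) ^ (q-1) * ((2:ℝ≥0∞) ^ m) ^ (q-1) * b ^ j * a := by
            rw [← mul_assoc, e1]
      _ ≤ (2:ℝ≥0∞) ^ q * (2:ℝ≥0∞) ^ (q-1) * a ^ (q-1) * b ^ j * a := by
            have : ((2:ℝ≥0∞) ^ m) ^ (q-1) ≤ a ^ (q-1) :=
              ENNReal.rpow_le_rpow hm1.le (by linarith)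
            gcongr
      _ = _ := by rw [e2]; ring
  calc ∑' j : ℕ, F (m + 1 - (j:ℤ)) ≤ ∑' j : ℕ, ((2:ℝ≥0∞) ^ q * (2:ℝ≥0∞) ^ (q-1) * a ^ q) * b ^ j :=
        ENNReal.tsum_le_tsum hterm
    _ = (2:ℝ≥0∞) ^ q * (2:ℝ≥0∞) ^ (q-1) * (1 - b)⁻¹ * a ^ q := by
        rw [ENNReal.tsum_mul_left, ENNReal.tsum_geometric]; ring
    _ ≤ _ := by gcongr; exact le_self_add

lemma strong_Mx (n : ℕ) {q : ℝ} (hq : 1 < q) : ∃ C : ℝ≥0∞, C ≠ ⊤ ∧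
    ∀ (μ : Measure (Euc n)) [SFinite μ] (f : Euc n → ℝ≥0∞), Measurable f →
      ∫⁻ x, Mx μ f x ^ q ∂μ ≤ C * ∫⁻ x, f x ^ q ∂μ := by
  obtain ⟨N, hN⟩ := weak_aux n
  obtain ⟨C, hC, hCb⟩ := layer_upper hq
  refine ⟨2 * N * C, ENNReal.mul_ne_top (ENNReal.mul_ne_top (by simp) (by simp)) hC,
    fun μ _ f hf => ?_⟩
  have hM := measurable_Mx μ hf
  have z0 : ∀ k : ℤ, (2:ℝ≥0∞) ^ k ≠ 0 := fun k => by
    exact (ENNReal.zpow_pos (by simp) (by simp) k).ne'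
  have zt : ∀ k : ℤ, (2:ℝ≥0∞) ^ k ≠ ⊤ := fun k => by
    exact (ENNReal.zpow_lt_top (by simp) (by simp) k).ne
  have m1 : ∀ k : ℤ, MeasurableSet {x | (2:ℝ≥0∞) ^ k < Mx μ f x} := fun k =>
    measurableSet_lt measurable_const hM
  have m2 : ∀ k : ℤ, MeasurableSet {x | (2:ℝ≥0∞) ^ k / 2 < f x} := fun k =>
    measurableSet_lt measurable_const hf
  calc ∫⁻ x, Mx μ f x ^ q ∂μ
      ≤ ∫⁻ x, ∑' k : ℤ, ((2:ℝ≥0∞) ^ (k+1)) ^ q *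
          (if (2:ℝ≥0∞) ^ k < Mx μ f x then 1 else 0) ∂μ :=
        lintegral_mono fun x => layer_lower _ hq
    _ = ∑' k : ℤ, ((2:ℝ≥0∞) ^ (k+1)) ^ q * μ {x | (2:ℝ≥0∞) ^ k < Mx μ f x} := by
        rw [lintegral_tsum]
        · refine tsum_congr fun k => ?_
          rw [lintegral_const_mul _ (Measurable.ite (m1 k) measurable_const measurable_const)]
          congr 1
          rw [← lintegral_indicator_one (m1 k)]
          refine lintegral_congr fun x => ?_
          simp [indicator_apply]
        · intro k
          exact ((Measurable.ite (m1 k) measurable_const measurable_const).const_mul _).aemeasurable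
    _ ≤ ∑' k : ℤ, ((2:ℝ≥0∞) ^ (k+1)) ^ q * ((2 * N) * ((2:ℝ≥0∞) ^ k)⁻¹ *
          ∫⁻ y in {y | (2:ℝ≥0∞) ^ k / 2 < f y}, f y ∂μ) := by
        refine ENNReal.tsum_le_tsum fun k => ?_
        gcongr
        exact hN μ f hf _ (z0 k) (zt k)
    _ = ∑' k : ℤ, ∫⁻ y, (2 * N) * (((2:ℝ≥0∞) ^ (k+1)) ^ q * (((2:ℝ≥0∞) ^ k)⁻¹ *
          (if (2:ℝ≥0∞) ^ k / 2 < f y then f y else 0))) ∂μ := by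
        refine tsum_congr fun k => ?_
        have mm : Measurable fun y => (if (2:ℝ≥0∞) ^ k / 2 < f y then f y else 0) :=
          Measurable.ite (m2 k) hf measurable_const
        rw [lintegral_const_mul _ ((mm.const_mul _).const_mul _),
          lintegral_const_mul _ (mm.const_mul _), lintegral_const_mul _ mm,
          ← lintegral_indicator (m2 k)]
        have : ∀ y, ({y | (2:ℝ≥0∞) ^ k / 2 < f y}).indicator (fun y => f y) y =
          (if (2:ℝ≥0∞) ^ k / 2 < f y then f y else 0) := fun y => by
            simp [indicator_apply]
        simp_rw [this]
        ring
    _ = ∫⁻ y, ∑' k : ℤ, (2 * N) * (((2:ℝ≥0∞) ^ (k+1)) ^ q * (((2:ℝ≥0∞) ^ k)⁻¹ *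
          (if (2:ℝ≥0∞) ^ k / 2 < f y then f y else 0))) ∂μ := by
        rw [lintegral_tsum]
        intro k
        have mm : Measurable fun y => (if (2:ℝ≥0∞) ^ k / 2 < f y then f y else 0) :=
          Measurable.ite (m2 k) hf measurable_const
        exact (((mm.const_mul _).const_mul _).const_mul _).aemeasurable
    _ ≤ ∫⁻ y, 2 * N * C * f y ^ q ∂μ := by
        refine lintegral_mono fun y => ?_
        rw [ENNReal.tsum_mul_left, mul_assoc (2 * (N:ℝ≥0∞))]
        gcongr
        exact hCb (f y)
    _ = _ := lintegral_const_mul _ (hf.pow_const q)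

lemma volume_Cube_ne_zero (a : Euc n) {h : ℝ} (hh : 0 < h) : volume (Cube a h) ≠ 0 := by
  rw [volume_Cube]; exact pow_ne_zero _ (by simpa using hh)

lemma volume_Cube_ne_top (a : Euc n) (h : ℝ) : volume (Cube a h) ≠ ⊤ := by
  rw [volume_Cube]; exact ENNReal.pow_ne_top ENNReal.ofReal_ne_top

/-- The bound defining the Muckenhoupt class, cube by cube. -/
def ArBd (r : ℝ) (V : Euc n → ℝ≥0∞) (A : ℝ≥0∞) : Prop :=
  ∀ (a : Euc n) (h : ℝ), 0 < h →
    ((volume (Cube a h))⁻¹ * ∫⁻ x in Cube a h, V x) *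
      ((volume (Cube a h))⁻¹ * ∫⁻ x in Cube a h, V x ^ (1 - dualExp r)) ^ (r - 1) ≤ A

lemma setLIntegral_ne_zero {s : Set (Euc n)} (h0 : volume s ≠ 0)
    {f : Euc n → ℝ≥0∞} (hf : Measurable f) (hpos : ∀ᵐ x, f x ≠ 0) : ∫⁻ x in s, f x ≠ 0 := by
  intro h
  rw [lintegral_eq_zero_iff hf] at h
  have h2 : ∀ᵐ x ∂(volume.restrict s), False := by
    filter_upwards [h, ae_restrict_of_ae hpos] with x hx hx2
    exact hx2 hx
  rw [Filter.eventually_false_iff_eq_bot, ae_eq_bot, Measure.restrict_eq_zero] at h2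
  exact h0 h2

lemma ArBd.bounds {r : ℝ} (hr : 1 < r) {V : Euc n → ℝ≥0∞} {A : ℝ≥0∞} (hA : ArBd r V A)
    (hAt : A ≠ ⊤) (hVm : Measurable V) (hV0 : ∀ᵐ x, V x ≠ 0) (hVt : ∀ x, V x ≠ ⊤)
    (a : Euc n) {h : ℝ} (hh : 0 < h) :
    ∫⁻ x in Cube a h, V x ≠ 0 ∧ ∫⁻ x in Cube a h, V x ≠ ⊤ ∧
    ∫⁻ x in Cube a h, V x ^ (1 - dualExp r) ≠ 0 ∧
    ∫⁻ x in Cube a h, V x ^ (1 - dualExp r) ≠ ⊤ := by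
  have c0 := volume_Cube_ne_zero a hh
  have ct := volume_Cube_ne_top a h
  have hd : 1 - dualExp r < 0 := by
    unfold dualExp
    rw [sub_neg, lt_div_iff₀ (by linarith)]; linarith
  have h1 := setLIntegral_ne_zero c0 hVm hV0
  have h2 : ∫⁻ x in Cube a h, V x ^ (1 - dualExp r) ≠ 0 :=
    setLIntegral_ne_zero c0 (hVm.pow_const _) (by
      refine Filter.Eventually.of_forall fun x => ?_
      rw [Ne, ENNReal.rpow_eq_zero_iff]
      rintro (⟨_, h⟩ | ⟨h, _⟩)
      · linarith
      · exact hVt x h)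
  have hb := ne_top_of_le_ne_top hAt (hA a h hh)
  have i0 : (volume (Cube a h))⁻¹ ≠ 0 := ENNReal.inv_ne_zero.2 ct
  refine ⟨h1, ?_, h2, ?_⟩
  · intro ht
    rw [ht, ENNReal.mul_top i0, ENNReal.top_mul] at hb
    · exact hb rfl
    · rw [Ne, ENNReal.rpow_eq_zero_iff_of_pos (by linarith)]
      exact mul_ne_zero i0 h2
  · intro ht
    rw [ht, ENNReal.mul_top i0, ENNReal.top_rpow_of_pos (by linarith), ENNReal.mul_top] at hb
    · exact hb rfl
    · exact mul_ne_zero i0 h1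

lemma ArBd.prod_le {r : ℝ} (hr : 1 < r) {V : Euc n → ℝ≥0∞} {A : ℝ≥0∞} (hA : ArBd r V A)
    (a : Euc n) {h : ℝ} (hh : 0 < h) :
    (∫⁻ x in Cube a h, V x) * (∫⁻ x in Cube a h, V x ^ (1 - dualExp r)) ^ (r-1) ≤
      A * volume (Cube a h) ^ r := by
  have c0 := volume_Cube_ne_zero a hh
  have ct := volume_Cube_ne_top a h
  have := hA a h hh
  set c := volume (Cube a h)
  set X := ∫⁻ x in Cube a h, V x
  set Y := ∫⁻ x in Cube a h, V x ^ (1 - dualExp r)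
  have e : c⁻¹ * X * (c⁻¹ * Y) ^ (r-1) = (c ^ r)⁻¹ * (X * Y ^ (r-1)) := by
    rw [ENNReal.mul_rpow_of_nonneg _ _ (by linarith), ENNReal.inv_rpow]
    have : c ^ r = c * c ^ (r-1) := by
      conv_rhs => rw [← ENNReal.rpow_one c, ← ENNReal.rpow_mul, one_mul]
      rw [← ENNReal.rpow_add _ _ c0 ct]; congr 1; ring
    rw [this, ENNReal.mul_inv (Or.inl c0) (Or.inl ct)]
    ring
  rw [e] at this
  have cr0 : c ^ r ≠ 0 := by
    rw [Ne, ENNReal.rpow_eq_zero_iff_of_pos (by linarith)]; exact c0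
  have crt : c ^ r ≠ ⊤ := ENNReal.rpow_ne_top_of_nonneg (by linarith) ct
  calc X * Y ^ (r-1) = (c ^ r)⁻¹ * (X * Y ^ (r-1)) * c ^ r := by
        rw [mul_comm _ (c ^ r), ← mul_assoc, ENNReal.mul_inv_cancel cr0 crt, one_mul]
    _ ≤ _ := by gcongr

lemma le_mul_Mx (μ : Measure (Euc n)) (f : Euc n → ℝ≥0∞) (x : Euc n) (k : ℤ)
    (h0 : μ (CQ x ((2:ℝ)^k)) ≠ 0) (ht : μ (CQ x ((2:ℝ)^k)) ≠ ⊤) :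
    ∫⁻ y in CQ x ((2:ℝ)^k), f y ∂μ ≤ μ (CQ x ((2:ℝ)^k)) * Mx μ f x := by
  have : (∫⁻ y in CQ x ((2:ℝ)^k), f y ∂μ) / μ (CQ x ((2:ℝ)^k)) ≤ Mx μ f x :=
    le_iSup (fun k : ℤ => (∫⁻ y in CQ x ((2:ℝ)^k), f y ∂μ) / μ (CQ x ((2:ℝ)^k))) k
  rw [ENNReal.div_le_iff h0 ht] at this
  rwa [mul_comm]

lemma buckley_pointwise {r : ℝ} (hr : 1 < r) {V : Euc n → ℝ≥0∞} {A : ℝ≥0∞} (hA : ArBd r V A)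
    (hAt : A ≠ ⊤) (hVm : Measurable V) (hV0 : ∀ᵐ x, V x ≠ 0) (hVt : ∀ x, V x ≠ ⊤)
    (f : Euc n → ℝ≥0∞) (hf : Measurable f) (x : Euc n) :
    Mx volume (fun y => f y * V y) x ≤ ((3:ℝ≥0∞) ^ n) ^ r * A *
      (Mx (volume.withDensity fun y => V y ^ (1 - dualExp r))
        (fun y => (Mx (volume.withDensity V) f y * V y) ^ (dualExp r - 1)) x) ^ (r-1) := by
  have hr1 : 0 < r - 1 := by linarith
  have hpr : (dualExp r - 1) * (r - 1) = 1 := by unfold dualExp; field_simp; ring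
  have hp1 : 0 < dualExp r - 1 := by
    by_contra h
    nlinarith
  set p := dualExp r with hp
  set μ := volume.withDensity V with hμ
  set ν := volume.withDensity (fun y => V y ^ (1 - p)) with hν
  have hσm : Measurable fun y => V y ^ (1 - p) := hVm.pow_const _
  have hMm := measurable_Mx μ hf
  set F : Euc n → ℝ≥0∞ := fun y => (Mx μ f y * V y) ^ (p - 1) with hF
  have hFm : Measurable F := (hMm.mul hVm).pow_const _
  refine iSup_le fun k => ?_
  have hk : (0:ℝ) < 2 ^ k := by positivity
  have mQ : ∀ x ρ, μ (CQ x ρ) = ∫⁻ y in CQ x ρ, V y := fun x ρ =>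
    withDensity_apply _ (measurableSet_CQ x ρ)
  have nQ : ∀ x ρ, ν (CQ x ρ) = ∫⁻ y in CQ x ρ, V y ^ (1 - p) := fun x ρ =>
    withDensity_apply _ (measurableSet_CQ x ρ)
  have bd : ∀ x ρ, 0 < ρ → μ (CQ x ρ) ≠ 0 ∧ μ (CQ x ρ) ≠ ⊤ ∧ ν (CQ x ρ) ≠ 0 ∧ ν (CQ x ρ) ≠ ⊤ := by
    intro x ρ hρ
    rw [mQ, nQ, CQ_eq_Cube]
    exact hA.bounds hr hAt hVm hV0 hVt _ (by linarith)
  set Q := CQ x ((2:ℝ)^k) with hQ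
  set Q3 := CQ x (3 * (2:ℝ)^k) with hQ3
  set I := ∫⁻ y in Q, f y * V y with hI
  set W := Mx ν F x with hW
  set c := volume Q with hc
  have c0 : c ≠ 0 := by rw [hc, hQ, CQ_eq_Cube]; exact volume_Cube_ne_zero _ (by linarith)
  have ct : c ≠ ⊤ := by rw [hc, hQ, CQ_eq_Cube]; exact volume_Cube_ne_top _ _
  have c3 : volume Q3 = 3 ^ n * c := by
    rw [hc, hQ, hQ3, volume_CQ, volume_CQ, ← mul_pow]
    congr 1
    rw [show (2:ℝ) * (3 * 2 ^ k) = 3 * (2 * 2 ^ k) by ring, ENNReal.ofReal_mul (by norm_num)]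
    simp
  have hAQ : μ Q3 * ν Q3 ^ (r-1) ≤ A * (3 ^ n * c) ^ r := by
    rw [← c3, mQ, nQ, hQ3, CQ_eq_Cube]
    exact hA.prod_le hr _ (by positivity)
  have s1 : ∀ y ∈ Q, I ≤ μ Q3 * Mx μ f y := by
    intro y hy
    have hQy : Q ⊆ CQ y ((2:ℝ)^(k+1)) := by
      intro z hz i
      have h1 := hz i
      have h2 := hy i
      rw [zpow_add_one₀ (by norm_num)]
      rw [abs_le] at *
      constructor <;> linarith
    have hy3 : CQ y ((2:ℝ)^(k+1)) ⊆ Q3 := by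
      intro z hz i
      have h1 := hz i
      have h2 := hy i
      rw [zpow_add_one₀ (by norm_num)] at h1
      rw [abs_le] at *
      constructor <;> linarith
    obtain ⟨b0, bt, -, -⟩ := bd y ((2:ℝ)^(k+1)) (by positivity)
    calc I ≤ ∫⁻ z in CQ y ((2:ℝ)^(k+1)), f z * V z := lintegral_mono_set hQy
      _ = ∫⁻ z in CQ y ((2:ℝ)^(k+1)), f z ∂μ := by
          rw [hμ, setLIntegral_withDensity_eq_setLIntegral_mul _ hVm hf (measurableSet_CQ _ _)]
          simp [mul_comm]
      _ ≤ μ (CQ y ((2:ℝ)^(k+1))) * Mx μ f y := le_mul_Mx μ f y (k+1) b0 bt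
      _ ≤ _ := by gcongr
  have s2 : I ^ (p-1) * c ≤ μ Q3 ^ (p-1) * ∫⁻ y in Q, Mx μ f y ^ (p-1) := by
    rw [← lintegral_const_mul _ (hMm.pow_const _), hc, ← setLIntegral_const]
    refine setLIntegral_mono' (measurableSet_CQ _ _) fun y hy => ?_
    rw [← ENNReal.mul_rpow_of_nonneg _ _ hp1.le]
    exact ENNReal.rpow_le_rpow (s1 y hy) hp1.le
  have s3 : ∫⁻ y in Q, Mx μ f y ^ (p-1) ≤ ν Q3 * W := by
    obtain ⟨-, -, b0, bt⟩ := bd x ((2:ℝ)^k) hk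
    calc ∫⁻ y in Q, Mx μ f y ^ (p-1) = ∫⁻ y in Q, F y ∂ν := by
          rw [hν, setLIntegral_withDensity_eq_setLIntegral_mul _ hσm hFm (measurableSet_CQ _ _)]
          refine lintegral_congr_ae (ae_restrict_of_ae ?_)
          filter_upwards [hV0] with y hy
          simp only [Pi.mul_apply, hF]
          rw [ENNReal.mul_rpow_of_nonneg _ _ hp1.le, mul_comm, mul_assoc,
            ← ENNReal.rpow_add _ _ hy (hVt y)]
          simp
      _ ≤ ν Q * W := le_mul_Mx ν F x k b0 bt
      _ ≤ ν Q3 * W := by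
          gcongr
          intro z hz i
          have := hz i
          linarith
  have s4 : I * c ^ (r-1) ≤ μ Q3 * ν Q3 ^ (r-1) * W ^ (r-1) := by
    have h1 : I ^ (p-1) * c ≤ μ Q3 ^ (p-1) * (ν Q3 * W) := s2.trans (by gcongr)
    have h2 := ENNReal.rpow_le_rpow h1 hr1.le
    rw [ENNReal.mul_rpow_of_nonneg _ _ hr1.le, ENNReal.mul_rpow_of_nonneg _ _ hr1.le,
      ENNReal.mul_rpow_of_nonneg _ _ hr1.le, ← ENNReal.rpow_mul, ← ENNReal.rpow_mul, hpr] at h2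
    simpa [mul_assoc] using h2
  have ec : c ^ r = c * c ^ (r-1) := by
    conv_rhs => rw [← ENNReal.rpow_one c, ← ENNReal.rpow_mul, one_mul]
    rw [← ENNReal.rpow_add _ _ c0 ct]; congr 1; ring
  have d0 : c ^ (r-1) ≠ 0 := by
    rw [Ne, ENNReal.rpow_eq_zero_iff_of_pos hr1]; exact c0
  have dt : c ^ (r-1) ≠ ⊤ := ENNReal.rpow_ne_top_of_nonneg hr1.le ct
  rw [ENNReal.div_le_iff c0 ct]
  rw [← ENNReal.mul_le_mul_iff_left d0 dt]
  calc I * c ^ (r-1) ≤ μ Q3 * ν Q3 ^ (r-1) * W ^ (r-1) := s4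
    _ ≤ A * (3 ^ n * c) ^ r * W ^ (r-1) := by gcongr
    _ = _ := by
      rw [ENNReal.mul_rpow_of_nonneg _ _ (by linarith), ec]; ring

lemma buckley (n : ℕ) {r : ℝ} (hr : 1 < r) : ∃ K : ℝ≥0∞, K ≠ ⊤ ∧ K ≠ 0 ∧
    ∀ (V : Euc n → ℝ≥0∞) (A : ℝ≥0∞), ArBd r V A → A ≠ ⊤ → Measurable V →
      (∀ᵐ x, V x ≠ 0) → (∀ x, V x ≠ ⊤) → ∀ f : Euc n → ℝ≥0∞, Measurable f →
      ∫⁻ x, (Mx volume (fun y => f y * V y) x / V x) ^ (dualExp r) * V x ≤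
        (K * A) ^ (dualExp r) * ∫⁻ x, f x ^ (dualExp r) * V x := by
  have hr1 : 0 < r - 1 := by linarith
  have hpr : (dualExp r - 1) * (r - 1) = 1 := by unfold dualExp; field_simp; ring
  have hp1 : 1 < dualExp r := by
    by_contra h
    nlinarith
  have hp0 : 0 < dualExp r := by linarith
  obtain ⟨C1, hC1, h1⟩ := strong_Mx n hr
  obtain ⟨C2, hC2, h2⟩ := strong_Mx n hp1
  set p := dualExp r with hp
  refine ⟨((3:ℝ≥0∞) ^ n) ^ r * ((C1 + 1) * (C2 + 1)) ^ (1/p), ?_, ?_, ?_⟩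
  · refine ENNReal.mul_ne_top (ENNReal.rpow_ne_top_of_nonneg (by linarith) (by simp)) ?_
    exact ENNReal.rpow_ne_top_of_nonneg (by positivity)
      (ENNReal.mul_ne_top (by simp [hC1]) (by simp [hC2]))
  · refine mul_ne_zero ?_ ?_
    · rw [Ne, ENNReal.rpow_eq_zero_iff_of_pos (by linarith)]; simp
    · rw [Ne, ENNReal.rpow_eq_zero_iff_of_pos (by positivity)]; simp
  intro V A hA hAt hVm hV0 hVt f hf
  have hpt := buckley_pointwise hr hA hAt hVm hV0 hVt f hf
  rw [← hp] at hpt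
  set μ := volume.withDensity V with hμ
  set ν := volume.withDensity (fun y => V y ^ (1 - p)) with hν
  have hσm : Measurable fun y => V y ^ (1 - p) := hVm.pow_const _
  have hMm := measurable_Mx μ hf
  set F : Euc n → ℝ≥0∞ := fun y => (Mx μ f y * V y) ^ (p - 1) with hF
  have hFm : Measurable F := (hMm.mul hVm).pow_const _
  have hWm := measurable_Mx ν hFm
  calc ∫⁻ x, (Mx volume (fun y => f y * V y) x / V x) ^ p * V x
      ≤ ∫⁻ x, ((((3:ℝ≥0∞) ^ n) ^ r * A) ^ p * (V x ^ (1-p) * Mx ν F x ^ r)) := by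
        refine lintegral_mono_ae ?_
        filter_upwards [hV0] with x hx
        have e : (Mx volume (fun y => f y * V y) x / V x) ^ p * V x =
            Mx volume (fun y => f y * V y) x ^ p * V x ^ (1-p) := by
          rw [div_eq_mul_inv, ENNReal.mul_rpow_of_nonneg _ _ hp0.le, mul_assoc, ENNReal.inv_rpow,
            ENNReal.rpow_sub _ _ hx (hVt x), ENNReal.rpow_one, div_eq_mul_inv, mul_comm (V x)]
        rw [e]
        have h3 := ENNReal.rpow_le_rpow (hpt x) hp0.le
        rw [ENNReal.mul_rpow_of_nonneg _ _ hp0.le, ← ENNReal.rpow_mul,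
          show (r-1) * p = r by linarith] at h3
        calc _ ≤ _ := mul_le_mul_left h3 _
          _ = _ := by ring
    _ = (((3:ℝ≥0∞) ^ n) ^ r * A) ^ p * ∫⁻ x, Mx ν F x ^ r ∂ν := by
        rw [lintegral_const_mul' _ _ ?_]
        · congr 1
          rw [hν, lintegral_withDensity_eq_lintegral_mul _ hσm (hWm.pow_const _)]
          rfl
        · exact ENNReal.rpow_ne_top_of_nonneg hp0.le (ENNReal.mul_ne_top
            (ENNReal.rpow_ne_top_of_nonneg (by linarith) (by simp)) hAt)
    _ ≤ (((3:ℝ≥0∞) ^ n) ^ r * A) ^ p * (C1 * ∫⁻ x, F x ^ r ∂ν) := by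
        gcongr
        exact h1 ν F hFm
    _ = (((3:ℝ≥0∞) ^ n) ^ r * A) ^ p * (C1 * ∫⁻ x, Mx μ f x ^ p ∂μ) := by
        congr 2
        rw [hν, hμ, lintegral_withDensity_eq_lintegral_mul _ hσm (hFm.pow_const _),
          lintegral_withDensity_eq_lintegral_mul _ hVm (hMm.pow_const _)]
        refine lintegral_congr_ae ?_
        filter_upwards [hV0] with x hx
        simp only [Pi.mul_apply, hF]
        rw [← ENNReal.rpow_mul, show (p-1) * r = p by linarith,
          ENNReal.mul_rpow_of_nonneg _ _ hp0.le, mul_comm (Mx _ f x ^ p), ← mul_assoc,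
          ← ENNReal.rpow_add _ _ hx (hVt x)]
        simp
    _ ≤ (((3:ℝ≥0∞) ^ n) ^ r * A) ^ p * (C1 * (C2 * ∫⁻ x, f x ^ p ∂μ)) := by
        gcongr
        exact h2 μ f hf
    _ ≤ (((3:ℝ≥0∞) ^ n) ^ r * A) ^ p * ((C1 + 1) * ((C2 + 1) * ∫⁻ x, f x ^ p ∂μ)) := by
        gcongr <;> exact le_self_add
    _ = _ := by
        rw [hμ, lintegral_withDensity_eq_lintegral_mul _ hVm (hf.pow_const _)]
        rw [show ((3:ℝ≥0∞) ^ n) ^ r * ((C1 + 1) * (C2 + 1)) ^ (1/p) * A =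
          (((3:ℝ≥0∞) ^ n) ^ r * A) * ((C1 + 1) * (C2 + 1)) ^ (1/p) by ring,
          ENNReal.mul_rpow_of_nonneg (((3:ℝ≥0∞) ^ n) ^ r * A) _ hp0.le,
          ← ENNReal.rpow_mul, one_div_mul_cancel hp0.ne', ENNReal.rpow_one]
        have : ∀ x, (V * fun x => f x ^ p) x = f x ^ p * V x := fun x => by
          simp [mul_comm]
        simp_rw [this]
        ring

/-- The auxiliary operator iterated in the Rubio de Francia algorithm. -/
def Sop (V f : Euc n → ℝ≥0∞) (x : Euc n) : ℝ≥0∞ := Mx volume (fun y => f y * V y) x / V x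

/-- The iterates. -/
def Git (V g : Euc n → ℝ≥0∞) (B : ℝ≥0∞) : ℕ → Euc n → ℝ≥0∞
  | 0 => fun _ => 0
  | m + 1 => fun x => g x + (2 * B)⁻¹ * Sop V (Git V g B m) x

lemma Sop_mono (V : Euc n → ℝ≥0∞) {f h : Euc n → ℝ≥0∞} (hfh : ∀ x, f x ≤ h x) (x : Euc n) :
    Sop V f x ≤ Sop V h x := by
  unfold Sop Mx
  gcongr with k y
  exact mul_le_mul_left (hfh y) _

lemma measurable_Sop {V : Euc n → ℝ≥0∞} (hV : Measurable V) {f : Euc n → ℝ≥0∞}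
    (hf : Measurable f) : Measurable (Sop V f) :=
  (measurable_Mx volume (hf.mul hV)).div hV

lemma measurable_Git {V : Euc n → ℝ≥0∞} (hV : Measurable V) {g : Euc n → ℝ≥0∞}
    (hg : Measurable g) (B : ℝ≥0∞) (m : ℕ) : Measurable (Git V g B m) := by
  induction m with
  | zero => exact measurable_const
  | succ m ih => exact hg.add ((measurable_Sop hV ih).const_mul _)

lemma monotone_Git (V g : Euc n → ℝ≥0∞) (B : ℝ≥0∞) : Monotone (Git V g B) := by
  refine monotone_nat_of_le_succ fun m => ?_
  induction m with
  | zero => intro x; exact zero_le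
  | succ m ih =>
    intro x
    simp only [Git]
    gcongr
    exact Sop_mono V (fun y => ih y) x

lemma rubio {V g : Euc n → ℝ≥0∞} {B : ℝ≥0∞} {p : ℝ} (hp : 1 < p) (hV : Measurable V)
    (hg : Measurable g) (hB0 : B ≠ 0) (hBt : B ≠ ⊤)
    (hB : ∀ f : Euc n → ℝ≥0∞, Measurable f →
      ∫⁻ x, (Mx volume (fun y => f y * V y) x / V x) ^ p * V x ≤ B ^ p * ∫⁻ x, f x ^ p * V x) :
    ∃ G : Euc n → ℝ≥0∞, Measurable G ∧ (∀ x, g x ≤ G x) ∧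
      (∫⁻ x, G x ^ p * V x) ^ (1/p) ≤ 2 * (∫⁻ x, g x ^ p * V x) ^ (1/p) ∧
      ∀ x, V x ≠ 0 → V x ≠ ⊤ → Mx volume (fun y => G y * V y) x ≤ 2 * B * (G x * V x) := by
  have p0 : 0 < p := by linarith
  set μ := volume.withDensity V with hμ
  have conv : ∀ f : Euc n → ℝ≥0∞, Measurable f → ∫⁻ x, f x ^ p * V x = ∫⁻ x, f x ^ p ∂μ := by
    intro f hf
    rw [hμ, lintegral_withDensity_eq_lintegral_mul _ hV (hf.pow_const _)]
    simp [mul_comm]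
  have mG := measurable_Git hV hg B
  have mono := monotone_Git V g B
  have bd : ∀ m, (∫⁻ x, Git V g B m x ^ p ∂μ) ^ (1/p) ≤ 2 * (∫⁻ x, g x ^ p ∂μ) ^ (1/p) := by
    intro m
    induction m with
    | zero => simp [Git, ENNReal.zero_rpow_of_pos p0, p0]
    | succ m ih =>
      have mS := measurable_Sop hV (mG m)
      have h1 := ENNReal.lintegral_Lp_add_le (μ := μ) (p := p) hg.aemeasurable
        (mS.const_mul (2 * B)⁻¹).aemeasurable hp.le
      have h2 : (∫⁻ x, ((2 * B)⁻¹ * Sop V (Git V g B m) x) ^ p ∂μ) ^ (1/p) ≤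
          2⁻¹ * (∫⁻ x, Git V g B m x ^ p ∂μ) ^ (1/p) := by
        have h3 : ∫⁻ x, ((2 * B)⁻¹ * Sop V (Git V g B m) x) ^ p ∂μ ≤
            (2⁻¹ : ℝ≥0∞) ^ p * ∫⁻ x, Git V g B m x ^ p ∂μ := by
          calc ∫⁻ x, ((2 * B)⁻¹ * Sop V (Git V g B m) x) ^ p ∂μ
              = ((2 * B)⁻¹) ^ p * ∫⁻ x, Sop V (Git V g B m) x ^ p ∂μ := by
                simp_rw [ENNReal.mul_rpow_of_nonneg _ _ p0.le]
                rw [lintegral_const_mul _ (mS.pow_const _)]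
            _ ≤ ((2 * B)⁻¹) ^ p * (B ^ p * ∫⁻ x, Git V g B m x ^ p ∂μ) := by
                rw [← conv _ mS, ← conv _ (mG m)]
                gcongr
                exact hB _ (mG m)
            _ = _ := by
                rw [← mul_assoc, ← ENNReal.mul_rpow_of_nonneg _ _ p0.le,
                  ENNReal.mul_inv (by simp) (by simp), mul_assoc, ENNReal.inv_mul_cancel hB0 hBt,
                  mul_one]
        calc _ ≤ ((2⁻¹ : ℝ≥0∞) ^ p * ∫⁻ x, Git V g B m x ^ p ∂μ) ^ (1/p) :=
              ENNReal.rpow_le_rpow h3 (by positivity)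
          _ = _ := by
              rw [ENNReal.mul_rpow_of_nonneg _ _ (by positivity), ← ENNReal.rpow_mul,
                mul_one_div_cancel p0.ne', ENNReal.rpow_one]
      calc (∫⁻ x, Git V g B (m+1) x ^ p ∂μ) ^ (1/p)
          ≤ (∫⁻ x, g x ^ p ∂μ) ^ (1/p) +
            (∫⁻ x, ((2 * B)⁻¹ * Sop V (Git V g B m) x) ^ p ∂μ) ^ (1/p) := h1
        _ ≤ (∫⁻ x, g x ^ p ∂μ) ^ (1/p) + 2⁻¹ * (2 * (∫⁻ x, g x ^ p ∂μ) ^ (1/p)) := by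
            gcongr
            exact h2.trans (by gcongr)
        _ = _ := by
            rw [← mul_assoc, ENNReal.inv_mul_cancel (by simp) (by simp), one_mul, two_mul]
  have mGs : Measurable fun x => ⨆ m, Git V g B m x := Measurable.iSup mG
  refine ⟨fun x => ⨆ m, Git V g B m x, mGs, fun x => ?_, ?_, ?_⟩
  · exact le_trans le_self_add (le_iSup (fun m => Git V g B m x) 1)
  · rw [conv _ mGs, conv _ hg]
    have : ∀ x, (⨆ m, Git V g B m x) ^ p = ⨆ m, Git V g B m x ^ p := fun x =>
      (ENNReal.orderIsoRpow p p0).map_iSup _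
    simp_rw [this]
    rw [lintegral_iSup (fun m => (mG m).pow_const _)
      (fun a b hab x => ENNReal.rpow_le_rpow (mono hab x) p0.le)]
    rw [show (⨆ m, ∫⁻ x, Git V g B m x ^ p ∂μ) ^ (1/p) = ⨆ m, (∫⁻ x, Git V g B m x ^ p ∂μ) ^ (1/p)
      from (ENNReal.orderIsoRpow (1/p) (by positivity)).map_iSup _]
    exact iSup_le bd
  · intro x hx0 hxt
    refine iSup_le fun k => ?_
    simp_rw [ENNReal.iSup_mul]
    rw [lintegral_iSup (f := fun m y => Git V g B m y * V y) (fun m => (mG m).mul hV)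
      (fun a b hab y => mul_le_mul_left (mono hab y) _), ENNReal.iSup_div]
    refine iSup_le fun m => ?_
    have h1 : Mx volume (fun y => Git V g B m y * V y) x ≤ 2 * B * (Git V g B (m+1) x * V x) := by
      have h2 : (2 * B)⁻¹ * Sop V (Git V g B m) x ≤ Git V g B (m+1) x := le_add_self
      have b0 : 2 * B ≠ 0 := by simp [hB0]
      have bt : 2 * B ≠ ⊤ := ENNReal.mul_ne_top (by simp) hBt
      calc Mx volume (fun y => Git V g B m y * V y) x = Sop V (Git V g B m) x * V x := by
            rw [Sop, ENNReal.div_mul_cancel hx0 hxt]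
        _ = 2 * B * ((2 * B)⁻¹ * Sop V (Git V g B m) x * V x) := by
            rw [← mul_assoc, ← mul_assoc, ENNReal.mul_inv_cancel b0 bt, one_mul]
        _ ≤ _ := by gcongr
    refine le_trans ?_ (h1.trans ?_)
    · exact le_iSup (fun k : ℤ => (∫⁻ y in CQ x ((2:ℝ) ^ k), Git V g B m y * V y) /
        volume (CQ x ((2:ℝ) ^ k))) k
    · gcongr
      exact le_iSup (fun m => Git V g B m x * V x) (m+1)

lemma avg_le_Mx (f : Euc n → ℝ≥0∞) (a : Euc n) {h : ℝ} (hh : 0 < h) {x : Euc n}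
    (hx : x ∈ Cube a h) :
    (volume (Cube a h))⁻¹ * ∫⁻ y in Cube a h, f y ≤ 4 ^ n * Mx volume f x := by
  obtain ⟨k, hk1, hk2⟩ := exists_mem_Ioc_zpow hh (one_lt_two : (1:ℝ) < 2)
  have hsub : Cube a h ⊆ CQ x ((2:ℝ)^(k+1)) := by
    intro y hy i
    have h1 := hy i
    have h2 := hx i
    rw [abs_le]
    constructor <;> linarith
  have v0 := volume_Cube_ne_zero a hh
  have vt := volume_Cube_ne_top a h
  have hv : volume (CQ x ((2:ℝ)^(k+1))) ≤ 4 ^ n * volume (Cube a h) := by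
    rw [volume_CQ, volume_Cube, ← mul_pow]
    gcongr
    rw [show (4:ℝ≥0∞) = ENNReal.ofReal 4 by simp, ← ENNReal.ofReal_mul (by norm_num)]
    refine ENNReal.ofReal_le_ofReal ?_
    rw [zpow_add_one₀ (by norm_num)]
    linarith
  have w0 : volume (CQ x ((2:ℝ)^(k+1))) ≠ 0 := by
    rw [CQ_eq_Cube]; exact volume_Cube_ne_zero _ (by positivity)
  have wt : volume (CQ x ((2:ℝ)^(k+1))) ≠ ⊤ := by
    rw [CQ_eq_Cube]; exact volume_Cube_ne_top _ _
  rw [mul_comm, ← div_eq_mul_inv, ENNReal.div_le_iff v0 vt]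
  calc ∫⁻ y in Cube a h, f y ≤ ∫⁻ y in CQ x ((2:ℝ)^(k+1)), f y := lintegral_mono_set hsub
    _ ≤ volume (CQ x ((2:ℝ)^(k+1))) * Mx volume f x := le_mul_Mx volume f x (k+1) w0 wt
    _ ≤ 4 ^ n * volume (Cube a h) * Mx volume f x := by gcongr
    _ = _ := by ring

lemma final_cube {r₀ r : ℝ} (hr₀ : 1 < r₀) (hr : r₀ < r) {V u : Euc n → ℝ≥0∞}
    {A D : ℝ≥0∞} (hA : ArBd r V A) (hDt : D ≠ ⊤)
    (hVm : Measurable V) (hum : Measurable u)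
    (hV0 : ∀ᵐ x, V x ≠ 0) (hVt : ∀ x, V x ≠ ⊤) (hut : ∀ᵐ x, u x ≠ ⊤)
    (a : Euc n) {h : ℝ} (hh : 0 < h)
    (hu : ∀ᵐ x, x ∈ Cube a h → (volume (Cube a h))⁻¹ * ∫⁻ y in Cube a h, u y ≤ D * u x) :
    ((volume (Cube a h))⁻¹ * ∫⁻ x in Cube a h, V x ^ (1 - (r-r₀)/(r-1)) * u x ^ ((r-r₀)/(r-1))) *
      ((volume (Cube a h))⁻¹ * ∫⁻ x in Cube a h,
        (V x ^ (1 - (r-r₀)/(r-1)) * u x ^ ((r-r₀)/(r-1))) ^ (1 - dualExp r₀)) ^ (r₀ - 1) ≤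
      A ^ (1 - (r-r₀)/(r-1)) * D ^ ((r-r₀)/(r-1)) := by
  have hr1 : 0 < r - 1 := by linarith
  have hr01 : 0 < r₀ - 1 := by linarith
  set θ := (r-r₀)/(r-1) with hθ
  have θ0 : 0 < θ := div_pos (by linarith) hr1
  have θ1 : 0 < 1 - θ := by
    rw [hθ, sub_pos, div_lt_one hr1]; linarith
  have e1 : (1-θ) * (1 - dualExp r₀) = 1 - dualExp r := by
    rw [hθ]; unfold dualExp; field_simp; ring
  have e2 : θ * (1 - dualExp r₀) = -(θ/(r₀-1)) := by
    unfold dualExp; field_simp; ring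
  have e3 : (1-θ) * (r-1) = r₀ - 1 := by
    rw [hθ]; field_simp; ring
  have c0 := volume_Cube_ne_zero a hh
  have ct := volume_Cube_ne_top a h
  set c := volume (Cube a h) with hc
  set m := c⁻¹ * ∫⁻ y in Cube a h, u y with hm
  have ci0 : c⁻¹ ≠ 0 := ENNReal.inv_ne_zero.2 ct
  have cit : c⁻¹ ≠ ⊤ := ENNReal.inv_ne_top.2 c0
  have hol : c⁻¹ * ∫⁻ x in Cube a h, V x ^ (1 - θ) * u x ^ θ ≤
      (c⁻¹ * ∫⁻ x in Cube a h, V x) ^ (1-θ) * m ^ θ := by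
    have h1 := ENNReal.lintegral_mul_norm_pow_le (μ := volume.restrict (Cube a h))
      hVm.aemeasurable hum.aemeasurable θ1.le θ0.le (by ring)
    calc _ ≤ c⁻¹ * ((∫⁻ x in Cube a h, V x) ^ (1-θ) * (∫⁻ x in Cube a h, u x) ^ θ) := by gcongr
      _ = _ := by
        rw [hm, ENNReal.mul_rpow_of_nonneg _ _ θ1.le, ENNReal.mul_rpow_of_nonneg _ _ θ0.le]
        have : c⁻¹ = c⁻¹ ^ (1-θ) * c⁻¹ ^ θ := by
          rw [← ENNReal.rpow_add _ _ ci0 cit]; simp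
        conv_lhs => rw [this]
        ring
  rcases eq_or_ne m 0 with m0 | m0
  · rw [m0, ENNReal.zero_rpow_of_pos θ0, mul_zero] at hol
    rw [le_zero_iff.1 hol, zero_mul]
    exact zero_le
  have hQ : MeasurableSet (Cube a h) := measurableSet_Cube a h
  have hne : ∃ᵐ x ∂(volume.restrict (Cube a h)), True := by
    rw [Filter.frequently_true_iff_neBot, ae_neBot, Ne, Measure.restrict_eq_zero]
    exact c0
  have hu' : ∀ᵐ x ∂(volume.restrict (Cube a h)), m ≤ D * u x := by
    rw [ae_restrict_iff' hQ]; exact hu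
  have hut' := ae_restrict_of_ae (s := Cube a h) hut
  have hV0' := ae_restrict_of_ae (s := Cube a h) hV0
  obtain ⟨x, -, hx1, hx2⟩ := (hne.and_eventually (hu'.and hut')).exists
  have mt : m ≠ ⊤ := ne_top_of_le_ne_top (ENNReal.mul_ne_top hDt hx2) hx1
  have D0 : D ≠ 0 := by
    rintro rfl
    rw [zero_mul, le_zero_iff] at hx1
    exact m0 hx1
  set E := ((m / D) ^ (θ/(r₀-1)))⁻¹ with hE
  have md0 : m / D ≠ 0 := by simp [ENNReal.div_eq_zero_iff, m0, hDt]
  have mdt : m / D ≠ ⊤ := ENNReal.div_ne_top mt D0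
  have hEt : E ≠ ⊤ := by
    rw [hE, ENNReal.inv_ne_top, Ne, ENNReal.rpow_eq_zero_iff_of_pos (by positivity)]
    exact md0
  have h2 : ∫⁻ x in Cube a h, (V x ^ (1 - θ) * u x ^ θ) ^ (1 - dualExp r₀) ≤
      E * ∫⁻ x in Cube a h, V x ^ (1 - dualExp r) := by
    rw [← lintegral_const_mul' _ _ hEt]
    refine lintegral_mono_ae ?_
    filter_upwards [hu', hut', hV0'] with x hx1 hx2 hx3
    have hx4 : u x ≠ 0 := by
      intro h0
      rw [h0, mul_zero, le_zero_iff] at hx1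
      exact m0 hx1
    rw [ENNReal.mul_rpow_of_ne_top (ENNReal.rpow_ne_top_of_nonneg θ1.le (hVt x))
      (ENNReal.rpow_ne_top_of_nonneg θ0.le hx2), ← ENNReal.rpow_mul, ← ENNReal.rpow_mul, e1, e2,
      mul_comm, ENNReal.rpow_neg]
    gcongr
    rw [hE]
    refine ENNReal.inv_le_inv.2 (ENNReal.rpow_le_rpow ?_ (by positivity))
    exact ENNReal.div_le_of_le_mul (by rwa [mul_comm])
  have hEr : E ^ (r₀-1) = ((m/D)^θ)⁻¹ := by
    rw [hE, ENNReal.inv_rpow, ← ENNReal.rpow_mul, div_mul_cancel₀ _ hr01.ne']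
  have hmD : m ^ θ * ((m/D)^θ)⁻¹ = D ^ θ := by
    rw [← ENNReal.inv_rpow, ← ENNReal.mul_rpow_of_nonneg _ _ θ0.le]
    congr 1
    rw [ENNReal.inv_div (Or.inl hDt) (Or.inl D0)]
    exact ENNReal.mul_div_cancel m0 mt
  set X := c⁻¹ * ∫⁻ x in Cube a h, V x
  set Y := c⁻¹ * ∫⁻ x in Cube a h, V x ^ (1 - dualExp r)
  have h3 : (c⁻¹ * ∫⁻ x in Cube a h, (V x ^ (1 - θ) * u x ^ θ) ^ (1 - dualExp r₀)) ^ (r₀ - 1) ≤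
      ((m/D)^θ)⁻¹ * Y ^ (r₀-1) := by
    rw [← hEr, ← ENNReal.mul_rpow_of_nonneg _ _ hr01.le]
    refine ENNReal.rpow_le_rpow ?_ hr01.le
    calc _ ≤ c⁻¹ * (E * ∫⁻ x in Cube a h, V x ^ (1 - dualExp r)) := by gcongr
      _ = _ := by ring
  calc _ ≤ (X ^ (1-θ) * m ^ θ) * (((m/D)^θ)⁻¹ * Y ^ (r₀-1)) := mul_le_mul' hol h3
    _ = X ^ (1-θ) * Y ^ (r₀-1) * (m ^ θ * ((m/D)^θ)⁻¹) := by ring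
    _ = (X * Y ^ (r-1)) ^ (1-θ) * D ^ θ := by
        rw [hmD, ENNReal.mul_rpow_of_nonneg X (Y ^ (r-1)) θ1.le, ← ENNReal.rpow_mul, mul_comm (r-1), e3]
    _ ≤ _ := by
        gcongr
        exact hA a h hh

lemma degenerate {r : ℝ} (hr : 1 < r) {V : Euc n → ℝ≥0∞} {A : ℝ≥0∞} (hA : ArBd r V A)
    (hAt : A ≠ ⊤) (hVm : Measurable V) (hz : ¬ ∀ᵐ x, V x = 0) : ∀ᵐ x, V x ≠ 0 := by
  by_contra hcon
  apply hz
  have hd : 1 - dualExp r < 0 := by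
    unfold dualExp
    rw [sub_neg, lt_div_iff₀ (by linarith)]; linarith
  set Z := {x | V x = 0} with hZ
  have hZm : MeasurableSet Z := hVm (measurableSet_singleton 0)
  have hZ0 : volume Z ≠ 0 := by
    intro h
    exact hcon (measure_eq_zero_iff_ae_notMem.1 h)
  let Q : ℕ → Set (Euc n) := fun m => CQ 0 (m+1)
  have hQmono : Monotone Q := by
    intro i j hij x hx k
    have := hx k
    have h2 : (i:ℝ) ≤ j := by exact_mod_cast hij
    linarith
  have hQun : ⋃ m, Q m = univ := by
    rw [eq_univ_iff_forall]
    intro x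
    obtain ⟨m, hm⟩ := exists_nat_ge ‖x‖
    refine mem_iUnion.2 ⟨m, fun i => ?_⟩
    have := PiLp.norm_apply_le x i
    rw [Real.norm_eq_abs] at this
    simp
    linarith
  obtain ⟨m₀, hm₀⟩ : ∃ m, volume (Z ∩ Q m) ≠ 0 := by
    by_contra! h
    apply hZ0
    rw [← inter_univ Z, ← hQun, inter_iUnion]
    exact measure_iUnion_null h
  have hvan : ∀ m, m₀ ≤ m → ∫⁻ x in Q m, V x = 0 := by
    intro m hm
    have htop : ∫⁻ x in Q m, V x ^ (1 - dualExp r) = ⊤ := by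
      rw [← top_le_iff]
      calc ⊤ = ⊤ * volume (Z ∩ Q m₀) := (ENNReal.top_mul hm₀).symm
        _ = ∫⁻ x in Z ∩ Q m₀, ⊤ := (setLIntegral_const _ _).symm
        _ ≤ ∫⁻ x in Z ∩ Q m₀, V x ^ (1 - dualExp r) := by
            refine setLIntegral_mono' (hZm.inter (measurableSet_CQ _ _)) fun x hx => ?_
            have : V x = 0 := hx.1
            rw [this, ENNReal.zero_rpow_of_neg hd]
        _ ≤ _ := lintegral_mono_set (inter_subset_right.trans (hQmono hm))
    by_contra hne
    have h2 := hA (WithLp.toLp 2 (fun i => (0 : Euc n) i - ((m:ℝ)+1))) (2 * ((m:ℝ)+1)) (by positivity)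
    have vt : volume (Q m) ≠ ⊤ := by simp only [Q]; rw [CQ_eq_Cube]; exact volume_Cube_ne_top _ _
    rw [← CQ_eq_Cube] at h2
    change ((volume (Q m))⁻¹ * ∫⁻ x in Q m, V x) *
      ((volume (Q m))⁻¹ * ∫⁻ x in Q m, V x ^ (1 - dualExp r)) ^ (r - 1) ≤ A at h2
    rw [htop, ENNReal.mul_top (ENNReal.inv_ne_zero.2 vt), ENNReal.top_rpow_of_pos (by linarith),
      ENNReal.mul_top (mul_ne_zero (ENNReal.inv_ne_zero.2 vt) hne), top_le_iff] at h2
    exact hAt h2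
  have hall : ∀ m, ∀ᵐ x, x ∈ Q m → V x = 0 := by
    intro m
    have h1 := hvan (max m m₀) (le_max_right _ _)
    rw [lintegral_eq_zero_iff hVm, Filter.EventuallyEq, ae_restrict_iff' (measurableSet_CQ _ _)] at h1
    filter_upwards [h1] with x hx hxm
    exact hx (hQmono (le_max_left _ _) hxm)
  filter_upwards [ae_all_iff.2 hall] with x hx
  have : x ∈ ⋃ m, Q m := by rw [hQun]; trivial
  obtain ⟨m, hm⟩ := mem_iUnion.1 this
  exact hx m hm

/-- Sharp Rubio de Francia algorithm (Lemma 3.1). -/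
theorem rubio_de_francia_sharp
    (n : ℕ) (hn : 0 < n) (r₀ r : ℝ) (hr₀ : 1 ≤ r₀) (hr : r₀ < r) :
    ∃ c : ℝ, 0 < c ∧ ∀ v g : Euc n → ℝ, Measurable v → (∀ x, 0 ≤ v x) → Ar r v < ⊤ →
      Measurable g → (∀ x, 0 ≤ g x) → vLp v g (dualExp (r / r₀)) < ⊤ →
      ∃ G : Euc n → ℝ,
        (∀ x, g x ≤ G x) ∧
        vLp v G (dualExp (r / r₀)) ≤ 2 * vLp v g (dualExp (r / r₀)) ∧
        Ar r₀ (fun x => G x * v x) ≤ ENNReal.ofReal c * Ar r v := by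
  have hr1 : 1 < r := by linarith
  have hr1' : 0 < r - 1 := by linarith
  have hrr : 0 < r - r₀ := by linarith
  obtain ⟨K, hKt, hK0, hK⟩ := buckley n hr1
  set θ := (r-r₀)/(r-1) with hθ
  have θ0 : 0 < θ := div_pos hrr hr1'
  have θ1 : θ ≤ 1 := by rw [hθ, div_le_one hr1']; linarith
  have hpr : (dualExp r - 1) * (r - 1) = 1 := by unfold dualExp; field_simp; ring
  have hp1 : 1 < dualExp r := by
    by_contra h
    nlinarith
  have hs : dualExp (r / r₀) = r / (r - r₀) := by unfold dualExp; field_simp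
  set s := dualExp (r / r₀) with hsdef
  set p := dualExp r with hpdef
  have p0 : 0 < p := by linarith
  have s0 : 0 < s := by rw [hs]; positivity
  have hsθ : θ * s = p := by rw [hs, hpdef, hθ]; unfold dualExp; field_simp
  have hps : 1/θ * p = s := by rw [← hsθ]; field_simp
  have hsp : 1/p * θ = 1/s := by rw [← hsθ]; field_simp
  set k0 : ℝ≥0∞ := (4 ^ n * (2 * K)) with hk0
  have k00 : k0 ≠ 0 := by simp [hk0, hK0]
  have k0t : k0 ≠ ⊤ := ENNReal.mul_ne_top (by simp) (ENNReal.mul_ne_top (by simp) hKt)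
  have kt : k0 ^ θ ≠ ⊤ := ENNReal.rpow_ne_top_of_nonneg θ0.le k0t
  refine ⟨(k0 ^ θ).toReal, ?_, ?_⟩
  · refine ENNReal.toReal_pos ?_ kt
    rw [Ne, ENNReal.rpow_eq_zero_iff_of_pos θ0]; exact k00
  intro v g hv hv0 hAfin hg hg0 hgfin
  rw [ENNReal.ofReal_toReal kt]
  set A := Ar r v with hAdef
  set V : Euc n → ℝ≥0∞ := fun x => ENNReal.ofReal (v x) with hVdef
  have hVm : Measurable V := hv.ennreal_ofReal
  have hVt : ∀ x, V x ≠ ⊤ := fun x => ENNReal.ofReal_ne_top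
  have hA : ArBd r V A := by
    intro a h hh
    have := le_iSup_of_le (f := fun a : Euc n => ⨆ (h : ℝ) (_ : 0 < h),
      ((volume (Cube a h))⁻¹ * ∫⁻ x in Cube a h, ENNReal.ofReal (v x)) *
      (if r = 1 then
        essSup (fun x => (ENNReal.ofReal (v x))⁻¹) (volume.restrict (Cube a h))
      else
        ((volume (Cube a h))⁻¹ * ∫⁻ x in Cube a h,
            ENNReal.ofReal (v x) ^ (1 - dualExp r)) ^ (r - 1))) a
      (le_iSup₂_of_le h hh le_rfl)
    rw [if_neg hr1.ne'] at this
    exact this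
  by_cases hz : ∀ᵐ x, V x = 0
  · refine ⟨g, fun x => le_rfl, ?_, ?_⟩
    · rw [two_mul]; exact le_self_add
    · refine le_trans ?_ zero_le
      refine iSup_le fun a => iSup_le fun h => iSup_le fun hh => ?_
      have : ∫⁻ x in Cube a h, ENNReal.ofReal (g x * v x) = 0 := by
        have hm : Measurable (fun x => ENNReal.ofReal (g x * v x)) := (hg.mul hv).ennreal_ofReal
        rw [lintegral_eq_zero_iff hm]
        refine ae_restrict_of_ae ?_
        filter_upwards [hz] with x hx
        have : v x = 0 := le_antisymm (ENNReal.ofReal_eq_zero.1 hx) (hv0 x)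
        simp [this]
      rw [this]; simp
  have hV0 := degenerate hr1 hA hAfin.ne hVm hz
  have hA0 : A ≠ 0 := by
    obtain ⟨b1, b2, b3, b4⟩ := hA.bounds hr1 hAfin.ne hVm hV0 hVt 0 (zero_lt_one : (0:ℝ) < 1)
    have h1 := hA 0 1 zero_lt_one
    intro h0
    rw [h0, le_zero_iff, mul_eq_zero, ENNReal.rpow_eq_zero_iff_of_pos hr1', mul_eq_zero,
      mul_eq_zero] at h1
    have i0 : (volume (Cube (0 : Euc n) 1))⁻¹ ≠ 0 := ENNReal.inv_ne_zero.2 (volume_Cube_ne_top _ _)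
    tauto
  set g0 : Euc n → ℝ≥0∞ := fun x => ENNReal.ofReal (g x) ^ (1/θ) with hg0def
  have hg0m : Measurable g0 := hg.ennreal_ofReal.pow_const _
  have hg0p : ∫⁻ x, g0 x ^ p * V x = ∫⁻ x, ENNReal.ofReal |g x| ^ s * V x := by
    refine lintegral_congr fun x => ?_
    simp only [hg0def]
    rw [← ENNReal.rpow_mul, hps, abs_of_nonneg (hg0 x)]
  obtain ⟨G0, mG0, hgG, hnorm, hMx⟩ := rubio (V := V) (g := g0) (B := K * A) hp1 hVm hg0m
    (mul_ne_zero hK0 hA0) (ENNReal.mul_ne_top hKt hAfin.ne)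
    (hK V A hA hAfin.ne hVm hV0 hVt)
  have hgint : ∫⁻ x, g0 x ^ p * V x ≠ ⊤ := by
    rw [hg0p]
    intro h
    unfold vLp at hgfin
    rw [h, ENNReal.top_rpow_of_pos (by positivity)] at hgfin
    exact lt_irrefl _ hgfin
  have hGint : ∫⁻ x, G0 x ^ p * V x ≠ ⊤ := by
    intro h
    rw [h, ENNReal.top_rpow_of_pos (by positivity), top_le_iff] at hnorm
    exact ENNReal.mul_ne_top (by simp) (ENNReal.rpow_ne_top_of_nonneg (by positivity) hgint) hnorm
  have hGfin : ∀ᵐ x, G0 x ≠ ⊤ := by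
    filter_upwards [ae_lt_top ((mG0.pow_const p).mul hVm) hGint, hV0] with x hx hx0 h
    simp only [Pi.mul_apply] at hx
    rw [h, ENNReal.top_rpow_of_pos p0, ENNReal.top_mul hx0] at hx
    exact lt_irrefl _ hx
  classical
  set G : Euc n → ℝ := fun x => if G0 x = ⊤ then g x else (G0 x ^ θ).toReal with hGdef
  have hGof : ∀ᵐ x, ENNReal.ofReal (G x) = G0 x ^ θ := by
    filter_upwards [hGfin] with x hx
    simp only [hGdef, if_neg hx]
    exact ENNReal.ofReal_toReal (ENNReal.rpow_ne_top_of_nonneg θ0.le hx)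
  have hGnn : ∀ x, 0 ≤ G x := by
    intro x
    simp only [hGdef]
    split_ifs
    · exact hg0 x
    · exact ENNReal.toReal_nonneg
  refine ⟨G, fun x => ?_, ?_, ?_⟩
  · simp only [hGdef]
    split_ifs with hx
    · exact le_rfl
    · rw [← ENNReal.ofReal_le_iff_le_toReal (ENNReal.rpow_ne_top_of_nonneg θ0.le hx)]
      have := ENNReal.rpow_le_rpow (hgG x) θ0.le
      simp only [hg0def] at this
      rwa [← ENNReal.rpow_mul, one_div_mul_cancel θ0.ne', ENNReal.rpow_one] at this
  · have e1 : ∫⁻ x, ENNReal.ofReal |G x| ^ s * ENNReal.ofReal (v x) = ∫⁻ x, G0 x ^ p * V x := by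
      refine lintegral_congr_ae ?_
      filter_upwards [hGof] with x hx
      rw [abs_of_nonneg (hGnn x), hx, ← ENNReal.rpow_mul, hsθ]
    unfold vLp
    rw [e1, ← hg0p, ← hsp, ENNReal.rpow_mul, ENNReal.rpow_mul]
    calc _ ≤ (2 * (∫⁻ x, g0 x ^ p * V x) ^ (1/p)) ^ θ := ENNReal.rpow_le_rpow hnorm θ0.le
      _ = 2 ^ θ * ((∫⁻ x, g0 x ^ p * V x) ^ (1/p)) ^ θ := ENNReal.mul_rpow_of_nonneg _ _ θ0.le
      _ ≤ 2 ^ (1:ℝ) * ((∫⁻ x, g0 x ^ p * V x) ^ (1/p)) ^ θ := by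
          gcongr
          norm_num
      _ = _ := by rw [ENNReal.rpow_one]
  · set u : Euc n → ℝ≥0∞ := fun x => G0 x * V x with hudef
    have hum : Measurable u := mG0.mul hVm
    have hut : ∀ᵐ x, u x ≠ ⊤ := by
      filter_upwards [hGfin] with x hx
      exact ENNReal.mul_ne_top hx (hVt x)
    have hW : ∀ᵐ x, ENNReal.ofReal (G x * v x) = V x ^ (1-θ) * u x ^ θ := by
      filter_upwards [hGof, hV0] with x hx hx0
      rw [ENNReal.ofReal_mul (hGnn x), hx]
      simp only [hudef]
      rw [ENNReal.mul_rpow_of_nonneg _ _ θ0.le, mul_comm (G0 x ^ θ), mul_comm (G0 x ^ θ),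
        ← mul_assoc, ← ENNReal.rpow_add _ _ hx0 (hVt x)]
      simp [hVdef]
    have hDu : ∀ (a : Euc n) (h : ℝ), 0 < h → ∀ᵐ x, x ∈ Cube a h →
        (volume (Cube a h))⁻¹ * ∫⁻ y in Cube a h, u y ≤ (k0 * A) * u x := by
      intro a h hh
      filter_upwards [hV0] with x hx0 hx
      calc _ ≤ 4 ^ n * Mx volume u x := avg_le_Mx u a hh hx
        _ ≤ 4 ^ n * (2 * (K * A) * (G0 x * V x)) := by
            gcongr
            exact hMx x hx0 (hVt x)
        _ = _ := by simp only [hudef, hk0]; ring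
    have hDt : k0 * A ≠ ⊤ := ENNReal.mul_ne_top k0t hAfin.ne
    have hconst : A ^ (1-θ) * (k0 * A) ^ θ = k0 ^ θ * A := by
      rw [ENNReal.mul_rpow_of_nonneg _ _ θ0.le, mul_left_comm, ← ENNReal.rpow_add _ _ hA0 hAfin.ne]
      simp
    refine iSup_le fun a => iSup_le fun h => iSup_le fun hh => ?_
    have hWr := ae_restrict_of_ae (s := Cube a h) hW
    rw [lintegral_congr_ae hWr]
    split_ifs with h1
    · have hθ1 : θ = 1 := by rw [hθ, h1]; exact div_self hr1'.ne'
      rw [← ENNReal.essSup_const_mul]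
      refine essSup_le_of_ae_le _ ?_
      have hDr : ∀ᵐ x ∂(volume.restrict (Cube a h)),
          (volume (Cube a h))⁻¹ * ∫⁻ y in Cube a h, u y ≤ (k0 * A) * u x := by
        rw [ae_restrict_iff' (measurableSet_Cube a h)]; exact hDu a h hh
      filter_upwards [hWr, hDr] with x hx hx2
      rw [hx]
      simp only [hθ1, sub_self, ENNReal.rpow_zero, one_mul, ENNReal.rpow_one]
      rw [← div_eq_mul_inv]
      exact ENNReal.div_le_of_le_mul hx2
    · have hr01 : 1 < r₀ := lt_of_le_of_ne hr₀ (Ne.symm h1)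
      have e2 : ∫⁻ x in Cube a h, ENNReal.ofReal (G x * v x) ^ (1 - dualExp r₀) =
          ∫⁻ x in Cube a h, (V x ^ (1-θ) * u x ^ θ) ^ (1 - dualExp r₀) := by
        refine lintegral_congr_ae ?_
        filter_upwards [hWr] with x hx
        rw [hx]
      rw [e2, ← hconst]
      exact final_cube hr01 hr hA hDt hVm hum hV0 hVt hut a hh (hDu a h hh)

end
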